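/- arXiv:1604.02862 — 3 statements merged into one kernel-verified Lean document; each statement's English description precedes it below -/
import Mathlib

section
/- Let S be a numerical semigroup and let Γ ⊆ G₀(S) be a set of atoms of G₀(S). If Δ ≠ Λ are two nonempty antichains of Γ (with respect to the ⋆-order), then ⋆_Δ ≠ ⋆_Λ. -/
/-- A numerical semigroup: a subset of ℕ containing 0, closed under addition,
with finite complement. -/
structure NumSgp where
  carrier : Set ℕ
  zero_mem : 0 ∈ carrier
  add_mem : ∀ a ∈ carrier, ∀ b ∈ carrier, a + b ∈ carrier
  cofinite : carrierᶜ.Finite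

/-- The copy of `S` inside ℤ. -/
def natS (S : NumSgp) : Set ℤ := (fun n : ℕ => (n : ℤ)) '' S.carrier

/-- A fractional ideal of `S`: a nonempty subset of ℤ, bounded below, with `I + S ⊆ I`. -/
def IsFracIdeal (S : NumSgp) (I : Set ℤ) : Prop :=
  I.Nonempty ∧ BddBelow I ∧ ∀ i ∈ I, ∀ s ∈ natS S, i + s ∈ I

/-- `(I − J) = {x ∈ ℤ : x + J ⊆ I}`. -/
def idealSub (I J : Set ℤ) : Set ℤ := {x : ℤ | ∀ j ∈ J, x + j ∈ I}

/-- `F₀(S)`: fractional ideals `I` with `S ⊆ I ⊆ ℕ` (hence with minimal element 0). -/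
def F0 (S : NumSgp) : Set (Set ℤ) :=
  {I | IsFracIdeal S I ∧ natS S ⊆ I ∧ I ⊆ {x : ℤ | 0 ≤ x}}

/-- The `v`-operation (divisorial closure): `I ↦ (S − (S − I))`. -/
def vOp (S : NumSgp) (I : Set ℤ) : Set ℤ := idealSub (natS S) (idealSub (natS S) I)

/-- An ideal is divisorial if it is `v`-closed. -/
def Divisorial (S : NumSgp) (I : Set ℤ) : Prop := vOp S I = I

/-- `G₀(S)`: the nondivisorial ideals in `F₀(S)`. -/
def G0 (S : NumSgp) : Set (Set ℤ) := {I | I ∈ F0 S ∧ ¬ Divisorial S I}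

/-- The action of the star operation `⋆_I` generated by `I`:
`J ↦ J^{⋆_I} = J^v ∩ (I − (I − J))`. -/
def starI (S : NumSgp) (I J : Set ℤ) : Set ℤ := vOp S J ∩ idealSub I (idealSub I J)

/-- The action of the star operation `⋆_Δ = inf_{I ∈ Δ} ⋆_I` generated by a set `Δ` of ideals:
`J ↦ J^{⋆_Δ} = J^v ∩ ⋂_{I ∈ Δ} (I − (I − J))`. -/
def starD (S : NumSgp) (Δ : Set (Set ℤ)) (J : Set ℤ) : Set ℤ :=
  vOp S J ∩ ⋂ I ∈ Δ, idealSub I (idealSub I J)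

/-- The ⋆-order: `I ≤⋆ J` iff `I` is `⋆_J`-closed. -/
def starle (S : NumSgp) (I J : Set ℤ) : Prop := starI S J I = I

/-- A star operation on `S`, given by its action on subsets of ℤ; it is normalized to be
the identity outside the fractional ideals, so that two star operations are equal iff they
agree on all fractional ideals. -/
structure StarOp (S : NumSgp) where
  toFun : Set ℤ → Set ℤ
  isFrac : ∀ I, IsFracIdeal S I → IsFracIdeal S (toFun I)
  subset_star : ∀ I, IsFracIdeal S I → I ⊆ toFun I
  mono : ∀ I J, IsFracIdeal S I → IsFracIdeal S J → I ⊆ J → toFun I ⊆ toFun J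
  idem : ∀ I, IsFracIdeal S I → toFun (toFun I) = toFun I
  transl : ∀ I, IsFracIdeal S I → ∀ a : ℤ,
    toFun ((fun x => a + x) '' I) = (fun x => a + x) '' toFun I
  star_S : toFun (natS S) = natS S
  default_eq : ∀ I, ¬ IsFracIdeal S I → toFun I = I

/-- The order on star operations: `s ≤ t` iff `I^s ⊆ I^t` for every fractional ideal `I`. -/
def StarOp.le {S : NumSgp} (s t : StarOp S) : Prop :=
  ∀ I, IsFracIdeal S I → s.toFun I ⊆ t.toFun I

/-- A star operation `s` is prime if whenever `s ≥ t ∧ u` (the infimum of two star operations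
being given by `I ↦ I^t ∩ I^u`), then `s ≥ t` or `s ≥ u`. -/
def StarOp.IsPrime {S : NumSgp} (s : StarOp S) : Prop :=
  ∀ t u : StarOp S,
    (∀ I, IsFracIdeal S I → t.toFun I ∩ u.toFun I ⊆ s.toFun I) →
    t.le s ∨ u.le s

/-- `I ∈ F₀(S)` is an atom if the star operation `⋆_I` is prime. -/
def AtomIdeal (S : NumSgp) (I : Set ℤ) : Prop :=
  I ∈ F0 S ∧ ∀ t u : StarOp S,
    (∀ J, IsFracIdeal S J → t.toFun J ∩ u.toFun J ⊆ starI S I J) →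
    (∀ J, IsFracIdeal S J → t.toFun J ⊆ starI S I J) ∨
    (∀ J, IsFracIdeal S J → u.toFun J ⊆ starI S I J)

/-- `M_a = {x ∈ ℕ : a − x ∉ S}`, the biggest ideal in `F₀(S)` not containing `a`. -/
def Mdual (S : NumSgp) (a : ℕ) : Set ℤ := {x : ℤ | 0 ≤ x ∧ ((a : ℤ) - x) ∉ natS S}

/-- `Q_a(S) = {I ∈ F₀(S) : a = sup(ℕ \ I), a ∈ I^v}`. -/
def Qa (S : NumSgp) (a : ℕ) : Set (Set ℤ) :=
  {I | I ∈ F0 S ∧ (a : ℤ) ∉ I ∧ (∀ x : ℤ, (a : ℤ) < x → x ∈ I) ∧ (a : ℤ) ∈ vOp S I}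

/-- The number of antichains (with respect to inclusion) of a family of ideals. -/
noncomputable def numInclAnti (Q : Set (Set ℤ)) : ℕ :=
  Set.ncard {Δ : Set (Set ℤ) | Δ ⊆ Q ∧ IsAntichain (· ⊆ ·) Δ}

/-- The `n`-th Dedekind number: the number of antichains of the power set of an
`n`-element set, ordered by inclusion. -/
noncomputable def dedekind (n : ℕ) : ℕ :=
  Nat.card {A : Set (Set (Fin n)) // IsAntichain (· ⊆ ·) A}

/-- `T(S) = (S − M_S) \ S`. -/
def Tset (S : NumSgp) : Set ℤ :=
  idealSub (natS S) ((fun n : ℕ => (n : ℤ)) '' (S.carrier \ {0})) \ natS S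

/-- The type `t(S) = |T(S)|`. -/
noncomputable def typeNum (S : NumSgp) : ℕ := (Tset S).ncard

/-- The Frobenius number `g(S)`: the largest integer not in `S`. -/
noncomputable def frob (S : NumSgp) : ℕ := sSup S.carrierᶜ

/-- The multiplicity `μ(S)`: the smallest nonzero element of `S`. -/
noncomputable def multNum (S : NumSgp) : ℕ := sInf (S.carrier \ {0})

/-- The degree of singularity `δ(S) = |ℕ \ S|`. -/
noncomputable def deltaNum (S : NumSgp) : ℕ := S.carrierᶜ.ncard

/-- `S` is symmetric if `g(S) − a ∈ S` for every `a ∈ ℕ \ S`. -/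
def IsSymmetricSgp (S : NumSgp) : Prop :=
  ∀ a : ℕ, a ∉ S.carrier → ((frob S : ℤ) - (a : ℤ)) ∈ natS S

theorem bidual_add {L I J : Set ℤ} {x y : ℤ} (hx : x ∈ idealSub L (idealSub L J))
    (hy : y ∈ idealSub I J) : x + y ∈ idealSub L (idealSub L I) := by
  intro z hz
  have h : y + z ∈ idealSub L J := by
    intro j hj
    have := hz _ (hy j hj)
    have e : y + z + j = z + (y + j) := by ring
    rwa [e]
  have := hx _ h
  rwa [add_assoc]

theorem subset_bidual (L J : Set ℤ) : J ⊆ idealSub L (idealSub L J) := by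
  intro x hx y hy
  rw [add_comm]
  exact hy x hx

theorem bidual_self (I : Set ℤ) : idealSub I (idealSub I I) ⊆ I := by
  intro x hx
  have := hx 0 (by intro j hj; simpa using hj)
  simpa using this

theorem bidual_mono (L : Set ℤ) {I J : Set ℤ} (h : I ⊆ J) :
    idealSub L (idealSub L I) ⊆ idealSub L (idealSub L J) := by
  intro x hx y hy
  exact hx y (fun j hj => hy j (h hj))

theorem bidual_idem (L : Set ℤ) {J K : Set ℤ} (h : K ⊆ idealSub L (idealSub L J)) :
    idealSub L (idealSub L K) ⊆ idealSub L (idealSub L J) := by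
  intro x hx y hy
  refine hx y (fun k hk => ?_)
  rw [add_comm]
  exact h hk y hy

theorem natS_zero (S : NumSgp) : (0 : ℤ) ∈ natS S := ⟨0, S.zero_mem, rfl⟩

theorem natS_nonneg {S : NumSgp} {x : ℤ} (h : x ∈ natS S) : 0 ≤ x := by
  obtain ⟨n, _, rfl⟩ := h
  simp

theorem natS_add {S : NumSgp} {x y : ℤ} (hx : x ∈ natS S) (hy : y ∈ natS S) :
    x + y ∈ natS S := by
  obtain ⟨n, hn, rfl⟩ := hx
  obtain ⟨m, hm, rfl⟩ := hy
  exact ⟨n + m, S.add_mem n hn m hm, by simp⟩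

theorem exists_conductor (S : NumSgp) : ∃ c : ℤ, ∀ x : ℤ, c ≤ x → x ∈ natS S := by
  obtain ⟨b, hb⟩ := S.cofinite.bddAbove
  refine ⟨b + 1, fun x hx => ?_⟩
  refine ⟨x.toNat, ?_, by simp; omega⟩
  by_contra h
  have := hb h
  omega

theorem bidual_S (S : NumSgp) {L J : Set ℤ} (hL : ∀ i ∈ L, ∀ s ∈ natS S, i + s ∈ L)
    {x s : ℤ} (hx : x ∈ idealSub L (idealSub L J)) (hs : s ∈ natS S) :
    x + s ∈ idealSub L (idealSub L J) := by
  intro y hy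
  have := hL _ (hx y hy) s hs
  have e : x + s + y = x + y + s := by ring
  rwa [e]

theorem vOp_bddBelow (S : NumSgp) {J : Set ℤ} (hJ : BddBelow J) : BddBelow (vOp S J) := by
  obtain ⟨b, hb⟩ := hJ
  obtain ⟨c, hc⟩ := exists_conductor S
  refine ⟨b - c, fun x hx => ?_⟩
  have := natS_nonneg (hx (c - b) (fun j hj => hc _ (by have := hb hj; omega)))
  omega

theorem bidual_transl (L J : Set ℤ) (a x : ℤ) :
    x ∈ idealSub L (idealSub L ((fun x => a + x) '' J)) ↔
      -a + x ∈ idealSub L (idealSub L J) := by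
  constructor
  · intro h y hy
    have := h (-a + y) (by
      rintro _ ⟨j, hj, rfl⟩
      have := hy j hj
      have e : -a + y + (a + j) = y + j := by ring
      simpa only [e] using this)
    have e : -a + x + y = x + (-a + y) := by ring
    rwa [e]
  · intro h y hy
    have := h (a + y) (by
      intro j hj
      have := hy _ ⟨j, hj, rfl⟩
      have e : a + y + j = y + (a + j) := by ring
      rw [e]; exact this)
    have e : x + y = -a + x + (a + y) := by ring
    rwa [e]

theorem mem_starD {S : NumSgp} {T : Set (Set ℤ)} {J : Set ℤ} {x : ℤ} :
    x ∈ starD S T J ↔ x ∈ vOp S J ∧ ∀ I ∈ T, x ∈ idealSub I (idealSub I J) := by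
  simp [starD]

theorem subset_starD (S : NumSgp) (T : Set (Set ℤ)) (J : Set ℤ) : J ⊆ starD S T J := by
  intro x hx
  exact mem_starD.2 ⟨subset_bidual _ _ hx, fun I _ => subset_bidual _ _ hx⟩

theorem starD_frac (S : NumSgp) {T : Set (Set ℤ)} (hT : T ⊆ F0 S) {J : Set ℤ}
    (hJ : IsFracIdeal S J) : IsFracIdeal S (starD S T J) := by
  refine ⟨hJ.1.mono (subset_starD S T J), (vOp_bddBelow S hJ.2.1).mono Set.inter_subset_left, ?_⟩
  intro i hi s hs
  rw [mem_starD] at hi ⊢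
  exact ⟨bidual_S S (fun _ h _ h' => natS_add h h') hi.1 hs,
    fun I hI => bidual_S S (hT hI).1.2.2 (hi.2 I hI) hs⟩

theorem transl_frac (S : NumSgp) {J : Set ℤ} (hJ : IsFracIdeal S J) (a : ℤ) :
    IsFracIdeal S ((fun x => a + x) '' J) := by
  refine ⟨hJ.1.image _, ?_, ?_⟩
  · obtain ⟨b, hb⟩ := hJ.2.1
    refine ⟨a + b, ?_⟩
    rintro _ ⟨j, hj, rfl⟩
    have := hb hj
    simpa using this
  · rintro _ ⟨j, hj, rfl⟩ s hs
    exact ⟨j + s, hJ.2.2 j hj s hs, by simp [add_assoc]⟩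

open Classical in
/-- The star operation generated by a set of ideals in `F₀(S)`. -/
noncomputable def starOpD (S : NumSgp) (T : Set (Set ℤ)) (hT : T ⊆ F0 S) : StarOp S where
  toFun J := if IsFracIdeal S J then starD S T J else J
  isFrac J hJ := by
    rw [if_pos hJ]; exact starD_frac S hT hJ
  subset_star J hJ := by
    rw [if_pos hJ]; exact subset_starD S T J
  mono I J hI hJ h := by
    rw [if_pos hI, if_pos hJ]
    intro x hx
    rw [mem_starD] at hx ⊢
    exact ⟨bidual_mono _ h hx.1, fun L hL => bidual_mono _ h (hx.2 L hL)⟩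
  idem J hJ := by
    rw [if_pos hJ, if_pos (starD_frac S hT hJ)]
    refine Set.Subset.antisymm ?_ (subset_starD _ _ _)
    intro x hx
    rw [mem_starD] at hx
    rw [mem_starD]
    exact ⟨bidual_idem _ (fun y hy => (mem_starD.1 hy).1) hx.1,
      fun L hL => bidual_idem _ (fun y hy => (mem_starD.1 hy).2 L hL) (hx.2 L hL)⟩
  transl J hJ a := by
    rw [if_pos hJ, if_pos (transl_frac S hJ a)]
    ext x
    have : x ∈ (fun x => a + x) '' starD S T J ↔ -a + x ∈ starD S T J := by simp
    rw [this, mem_starD, mem_starD]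
    simp only [vOp, bidual_transl]
  star_S := by
    split_ifs
    · exact Set.Subset.antisymm (fun x hx => bidual_self _ (mem_starD.1 hx).1) (subset_starD _ _ _)
    · rfl
  default_eq J hJ := by rw [if_neg hJ]

theorem starOpD_apply (S : NumSgp) (T : Set (Set ℤ)) (hT : T ⊆ F0 S) {J : Set ℤ}
    (hJ : IsFracIdeal S J) : (starOpD S T hT).toFun J = starD S T J := by
  simp [starOpD, hJ]

theorem starI_self (S : NumSgp) (I : Set ℤ) : starI S I I ⊆ I :=
  fun _ hx => bidual_self I hx.2

theorem subset_starI (S : NumSgp) (I J : Set ℤ) : J ⊆ starI S I J :=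
  fun _ hx => ⟨subset_bidual _ _ hx, subset_bidual _ _ hx⟩

theorem F0_finite (S : NumSgp) : (F0 S).Finite := by
  refine Set.Finite.of_finite_image (f := fun I : Set ℤ => {n : ℕ | (n : ℤ) ∈ I} ∩ S.carrierᶜ)
    (S.cofinite.finite_subsets.subset ?_) ?_
  · rintro _ ⟨I, _, rfl⟩
    exact Set.inter_subset_right
  · intro I hI J hJ h
    have key : ∀ n : ℕ, (n : ℤ) ∈ I ↔ (n : ℤ) ∈ J := by
      intro n
      by_cases hn : n ∈ S.carrier
      · have : (n : ℤ) ∈ natS S := ⟨n, hn, rfl⟩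
        exact ⟨fun _ => hJ.2.1 this, fun _ => hI.2.1 this⟩
      · have := Set.ext_iff.1 h n
        simpa [hn] using this
    ext x
    constructor
    · intro hx
      have h0 : 0 ≤ x := hI.2.2 hx
      lift x to ℕ using h0
      exact (key x).1 hx
    · intro hx
      have h0 : 0 ≤ x := hJ.2.2 hx
      lift x to ℕ using h0
      exact (key x).2 hx

theorem exists_le_of_prime (S : NumSgp) {I : Set ℤ} (hI : I ∈ G0 S) (hA : AtomIdeal S I)
    {T : Set (Set ℤ)} (hf : T.Finite) : T ⊆ F0 S →
    (∀ J, IsFracIdeal S J → starD S T J ⊆ starI S I J) →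
    ∃ L ∈ T, ∀ J, IsFracIdeal S J → starI S L J ⊆ starI S I J := by
  induction T, hf using Set.Finite.induction_on with
  | empty =>
    intro _ h
    exfalso
    apply hI.2
    refine Set.Subset.antisymm ?_ (subset_bidual _ _)
    intro x hx
    exact starI_self S I (h I hI.1.1 (mem_starD.2 ⟨hx, by simp⟩))
  | @insert a T _ _ ih =>
    intro hT h
    have ha : ({a} : Set (Set ℤ)) ⊆ F0 S := by
      rintro _ rfl; exact hT (Set.mem_insert _ _)
    have hT' : T ⊆ F0 S := (Set.subset_insert a T).trans hT
    rcases hA.2 (starOpD S {a} ha) (starOpD S T hT') (by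
      intro J hJ x hx
      rw [starOpD_apply _ _ _ hJ, starOpD_apply _ _ _ hJ] at hx
      refine h J hJ (mem_starD.2 ⟨(mem_starD.1 hx.1).1, ?_⟩)
      rintro L (rfl | hL)
      · exact (mem_starD.1 hx.1).2 _ rfl
      · exact (mem_starD.1 hx.2).2 _ hL) with h1 | h1
    · refine ⟨a, Set.mem_insert _ _, fun J hJ x hx => ?_⟩
      apply h1 J hJ
      rw [starOpD_apply _ _ _ hJ, mem_starD]
      refine ⟨hx.1, ?_⟩
      rintro _ rfl
      exact hx.2
    · obtain ⟨L, hL, h2⟩ := ih hT' (fun J hJ => by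
        have := h1 J hJ
        rwa [starOpD_apply _ _ _ hJ] at this)
      exact ⟨L, Set.mem_insert_of_mem _ hL, h2⟩

theorem G0_antisymm (S : NumSgp) {I J : Set ℤ} (hI : I ∈ G0 S) (hJ : J ∈ G0 S)
    (h1 : starI S J I ⊆ I) (h2 : starI S I J ⊆ J) : I = J := by
  by_contra hne
  have hfin : ∃ x ∈ vOp S I \ I, ∀ y ∈ vOp S I \ I, y ≤ x := by
    obtain ⟨c, hc⟩ := exists_conductor S
    have hn : (vOp S I \ I).Nonempty := by
      rw [Set.nonempty_iff_ne_empty]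
      intro h
      exact hI.2 (Set.Subset.antisymm (Set.diff_eq_empty.1 h) (subset_bidual _ _))
    have hb : BddAbove (vOp S I \ I) := ⟨c, fun y hy => by
      by_contra hlt
      exact hy.2 (hI.1.2.1 (hc y (by omega)))⟩
    exact ⟨_, Int.csSup_mem hn hb, fun y hy => le_csSup hb hy⟩
  obtain ⟨x, hx, hmax⟩ := hfin
  apply hx.2
  apply h1
  refine ⟨hx.1, fun γ hγ => ?_⟩
  apply h2
  refine ⟨bidual_add hx.1 hγ, fun δ hδ => ?_⟩
  have I0 : (0 : ℤ) ∈ I := hI.1.2.1 (natS_zero S)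
  have J0 : (0 : ℤ) ∈ J := hJ.1.2.1 (natS_zero S)
  have g0 : 0 ≤ γ := by
    have : γ + 0 ∈ {x : ℤ | 0 ≤ x} := hJ.1.2.2 (hγ 0 I0)
    simpa using this
  have d0 : 0 ≤ δ := by
    have : δ + 0 ∈ {x : ℤ | 0 ≤ x} := hI.1.2.2 (hδ 0 J0)
    simpa using this
  have hpos : 0 < γ + δ := by
    by_contra hle
    have hg : γ = 0 := by omega
    have hd : δ = 0 := by omega
    subst hg hd
    exact hne (Set.Subset.antisymm (fun z hz => by simpa using hγ z hz)
      (fun z hz => by simpa using hδ z hz))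
  have hv : x + γ + δ ∈ vOp S I := bidual_add (bidual_add hx.1 hγ) hδ
  by_contra hni
  have := hmax _ ⟨hv, hni⟩
  omega

theorem exists_le_of_starD_le (S : NumSgp) {I : Set ℤ} (hI : I ∈ G0 S) (hA : AtomIdeal S I)
    {T : Set (Set ℤ)} (hT : T ⊆ F0 S) (h : starD S T I ⊆ I) :
    ∃ L ∈ T, ∀ J, IsFracIdeal S J → starI S L J ⊆ starI S I J := by
  refine exists_le_of_prime S hI hA ((F0_finite S).subset hT) hT ?_
  intro J _ x hx
  rw [mem_starD] at hx
  refine ⟨hx.1, fun y hy => h ?_⟩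
  exact mem_starD.2 ⟨bidual_add hx.1 hy, fun L hL => bidual_add (hx.2 L hL) hy⟩

theorem antichain_subset (S : NumSgp)
    (Γ : Set (Set ℤ)) (hΓ : Γ ⊆ G0 S) (hatoms : ∀ I ∈ Γ, AtomIdeal S I)
    (Δ Λ : Set (Set ℤ)) (hΔΓ : Δ ⊆ Γ) (hΛΓ : Λ ⊆ Γ)
    (hΔa : IsAntichain (starle S) Δ)
    (heq : ∀ K, IsFracIdeal S K → starD S Δ K = starD S Λ K) : Δ ⊆ Λ := by
  have hF : ∀ {T : Set (Set ℤ)}, T ⊆ Γ → T ⊆ F0 S := fun h I hI => (hΓ (h hI)).1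
  have hcl : ∀ {T : Set (Set ℤ)} {I : Set ℤ}, I ∈ T → starD S T I ⊆ I :=
    fun hI x hx => bidual_self _ ((mem_starD.1 hx).2 _ hI)
  intro I hI
  have gI := hΓ (hΔΓ hI)
  obtain ⟨L, hL, h1⟩ := exists_le_of_starD_le S gI (hatoms I (hΔΓ hI)) (hF hΛΓ)
    (by rw [← heq I gI.1.1]; exact hcl hI)
  have gL := hΓ (hΛΓ hL)
  obtain ⟨I', hI', h2⟩ := exists_le_of_starD_le S gL (hatoms L (hΛΓ hL)) (hF hΔΓ)
    (by rw [heq L gL.1.1]; exact hcl hL)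
  have hII : I = I' := by
    by_contra hne
    refine hΔa hI hI' hne (Set.Subset.antisymm ?_ (subset_starI _ _ _))
    exact ((h2 I gI.1.1).trans (h1 I gI.1.1)).trans (starI_self S I)
  subst hII
  have : I = L := G0_antisymm S gI gL ((h1 I gI.1.1).trans (starI_self S I))
    ((h2 L gL.1.1).trans (starI_self S L))
  rwa [this]

/-- Distinct nonempty antichains (for the ⋆-order) consisting of atoms of `G₀(S)`
generate different star operations. -/
theorem antichains_of_atoms_generate_different_stars (S : NumSgp)
    (Γ : Set (Set ℤ)) (hΓ : Γ ⊆ G0 S) (hatoms : ∀ I ∈ Γ, AtomIdeal S I)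
    (Δ Λ : Set (Set ℤ)) (hΔΓ : Δ ⊆ Γ) (hΛΓ : Λ ⊆ Γ)
    (hΔne : Δ.Nonempty) (hΛne : Λ.Nonempty)
    (hΔa : IsAntichain (starle S) Δ) (hΛa : IsAntichain (starle S) Λ)
    (hne : Δ ≠ Λ) :
    ∃ K : Set ℤ, IsFracIdeal S K ∧ starD S Δ K ≠ starD S Λ K := by
  by_contra hcon
  push Not at hcon
  exact hne (Set.Subset.antisymm
    (antichain_subset S Γ hΓ hatoms Δ Λ hΔΓ hΛΓ hΔa hcon)
    (antichain_subset S Γ hΓ hatoms Λ Δ hΛΓ hΔΓ hΛa (fun K hK => (hcon K hK).symm)))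
end

section
/- Let S be a numerical semigroup with type t := t(S). Then |Star(S)| ≥ 2·(Σ_{i=1}^{t−1} D(i)) − 3(t − 1), where D(i) is the i-th Dedekind number. -/
open Set

namespace StarCount

/-- closed under adding elements of `S` -/
def Cl (S : NumSgp) (I : Set ℤ) : Prop := ∀ i ∈ I, ∀ s ∈ natS S, i + s ∈ I

lemma natS_nonneg {S : NumSgp} {x : ℤ} (h : x ∈ natS S) : 0 ≤ x := by
  obtain ⟨n, _, rfl⟩ := h
  exact Int.natCast_nonneg n

lemma natS_zero (S : NumSgp) : (0 : ℤ) ∈ natS S := ⟨0, S.zero_mem, rfl⟩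

lemma natS_add {S : NumSgp} {x y : ℤ} (hx : x ∈ natS S) (hy : y ∈ natS S) : x + y ∈ natS S := by
  obtain ⟨n, hn, rfl⟩ := hx
  obtain ⟨m, hm, rfl⟩ := hy
  exact ⟨n + m, S.add_mem _ hn _ hm, by push_cast; rfl⟩

lemma exists_cond (S : NumSgp) : ∃ c : ℤ, 0 < c ∧ ∀ x, c ≤ x → x ∈ natS S := by
  obtain ⟨N, hN⟩ := S.cofinite.bddAbove
  refine ⟨N + 1, by positivity, fun x hx => ?_⟩
  refine ⟨x.toNat, ?_, by simp; omega⟩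
  by_contra h
  have := hN h
  omega

lemma mem_Tset {S : NumSgp} {y : ℤ} :
    y ∈ Tset S ↔ (∀ s ∈ natS S, s ≠ 0 → y + s ∈ natS S) ∧ y ∉ natS S := by
  unfold Tset idealSub
  constructor
  · rintro ⟨h1, h2⟩
    refine ⟨?_, h2⟩
    rintro s ⟨n, hn, rfl⟩ hs
    exact h1 _ ⟨n, ⟨hn, by simpa using hs⟩, rfl⟩
  · rintro ⟨h1, h2⟩
    refine ⟨?_, h2⟩
    rintro _ ⟨n, ⟨hn, hn0⟩, rfl⟩
    exact h1 _ ⟨n, hn, rfl⟩ (by simpa using hn0)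

lemma Tset_finite (S : NumSgp) : (Tset S).Finite := by
  obtain ⟨c, hc, h⟩ := exists_cond S
  apply (Set.finite_Icc (-c) c).subset
  intro y hy
  rw [mem_Tset] at hy
  constructor
  · have := natS_nonneg (hy.1 c (h c le_rfl) hc.ne')
    omega
  · by_contra hlt
    exact hy.2 (h y (by omega))

lemma Tset_nonempty (S : NumSgp) : (Tset S).Nonempty := by
  obtain ⟨c, hc, h⟩ := exists_cond S
  obtain ⟨g, hg, hm⟩ := Int.exists_greatest_of_bdd (P := fun z => z ∉ natS S)
    ⟨c, fun z hz => by by_contra hlt; exact hz (h z (by omega))⟩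
    ⟨-1, fun hz => by have := natS_nonneg hz; omega⟩
  refine ⟨g, mem_Tset.2 ⟨fun s hs hs0 => ?_, hg⟩⟩
  by_contra hn
  have := hm _ hn
  have := natS_nonneg hs
  omega

lemma exists_mult (S : NumSgp) (y d : ℤ) (hd : 0 < d) : ∃ k : ℕ, y + k * d ∈ natS S := by
  obtain ⟨c, hc, h⟩ := exists_cond S
  refine ⟨(c - y).toNat, h _ ?_⟩
  have : c - y ≤ ((c - y).toNat : ℤ) := Int.self_le_toNat _
  have h0 : (0 : ℤ) ≤ ((c - y).toNat : ℤ) := Int.natCast_nonneg _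
  nlinarith

/-- if `T` has two different elements, then all elements are nonnegative -/
lemma Tset_nonneg {S : NumSgp} {y z : ℤ} (hy : y ∈ Tset S) (hz : z ∈ Tset S) (hne : z ≠ y) :
    0 ≤ y := by
  classical
  by_contra hneg
  have hy := mem_Tset.1 hy
  have hz := mem_Tset.1 hz
  obtain ⟨d, rfl⟩ : ∃ d, y = -d := ⟨-y, by ring⟩
  have hd : 0 < d := by omega
  have hdS : d ∈ natS S := by
    have hex := exists_mult S d d hd
    have h1 := Nat.find_spec hex
    have h2 := fun m => Nat.find_min hex (m := m)
    generalize Nat.find hex = k at h1 h2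
    rcases k with _ | k
    · simpa using h1
    · exfalso
      apply h2 k (by omega)
      have := hy.1 _ h1 (by positivity)
      have e : -d + (d + ((k + 1 : ℕ) : ℤ) * d) = d + k * d := by push_cast; ring
      rwa [e] at this
  have hex := exists_mult S z d hd
  have h1 := Nat.find_spec hex
  have h2 := fun m => Nat.find_min hex (m := m)
  generalize Nat.find hex = k at h1 h2
  rcases k with _ | k
  · exact hz.2 (by simpa using h1)
  · by_cases h0 : z + ((k + 1 : ℕ) : ℤ) * d = 0
    · have h3 := natS_nonneg (hz.1 d hdS hd.ne')
      push_cast at h0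
      rcases k with _ | k
      · apply hne
        push_cast at h0
        linarith
      · push_cast at h0
        have : (0 : ℤ) ≤ k := Int.natCast_nonneg _
        nlinarith
    · apply h2 k (by omega)
      have := hy.1 _ h1 h0
      have e : -d + (z + ((k + 1 : ℕ) : ℤ) * d) = z + k * d := by push_cast; ring
      rwa [e] at this

/-! ### Star operations generated by sets -/

lemma idealSub_anti {I J K : Set ℤ} (h : J ⊆ K) : idealSub I K ⊆ idealSub I J :=
  fun _ hx j hj => hx j (h hj)

lemma subset_dd (I J : Set ℤ) : J ⊆ idealSub I (idealSub I J) := by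
  intro j hj x hx
  rw [add_comm]
  exact hx j hj

lemma vOp_cl (S : NumSgp) (I J : Set ℤ) (hI : Cl S I) : Cl S (idealSub I J) := by
  intro y hy s hs x hx
  have := hI _ (hy x hx) s hs
  rwa [show y + s + x = y + x + s by ring]

lemma natS_frac (S : NumSgp) : IsFracIdeal S (natS S) :=
  ⟨⟨0, natS_zero S⟩, ⟨0, fun _ h => natS_nonneg h⟩, fun _ h _ h' => natS_add h h'⟩

lemma vOp_bdd (S : NumSgp) (J : Set ℤ) (hJ : IsFracIdeal S J) : BddBelow (vOp S J) := by
  obtain ⟨c, hc, h⟩ := exists_cond S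
  obtain ⟨m, hm⟩ := hJ.2.1
  refine ⟨m - c, fun y hy => ?_⟩
  have := natS_nonneg (hy (c - m) (fun j hj => h _ (by have := hm hj; omega)))
  omega

lemma dd_transl (I J : Set ℤ) (a y : ℤ) :
    y ∈ idealSub I (idealSub I ((fun x => a + x) '' J)) ↔ y - a ∈ idealSub I (idealSub I J) := by
  constructor
  · intro h x hx
    have := h (x - a) (by
      rintro _ ⟨j, hj, rfl⟩
      have := hx j hj
      simpa [show x - a + (a + j) = x + j by ring] using this)
    rwa [show y - a + x = y + (x - a) by ring]
  · intro h x hx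
    have := h (x + a) (by
      intro j hj
      have := hx (a + j) ⟨j, hj, rfl⟩
      rwa [show x + a + j = x + (a + j) by ring])
    rwa [show y + x = y - a + (x + a) by ring]

lemma mem_starD {S : NumSgp} {Θ : Set (Set ℤ)} {J : Set ℤ} {y : ℤ} :
    y ∈ starD S Θ J ↔ y ∈ vOp S J ∧ ∀ I ∈ Θ, y ∈ idealSub I (idealSub I J) := by
  simp [starD]

lemma dd_mono {I J K : Set ℤ} (h : J ⊆ K) :
    idealSub I (idealSub I J) ⊆ idealSub I (idealSub I K) :=
  idealSub_anti (idealSub_anti h)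

lemma dd_idem {I J K : Set ℤ} (h : K ⊆ idealSub I (idealSub I J)) :
    idealSub I (idealSub I K) ⊆ idealSub I (idealSub I J) := by
  apply idealSub_anti
  exact (subset_dd I (idealSub I J)).trans (idealSub_anti h)

lemma subset_starD (S : NumSgp) (Θ : Set (Set ℤ)) (J : Set ℤ) : J ⊆ starD S Θ J :=
  fun _ hy => mem_starD.2 ⟨subset_dd _ _ hy, fun _ _ => subset_dd _ _ hy⟩

lemma starD_frac {S : NumSgp} {Θ : Set (Set ℤ)} (hΘ : ∀ I ∈ Θ, Cl S I) {J : Set ℤ}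
    (hJ : IsFracIdeal S J) : IsFracIdeal S (starD S Θ J) := by
  refine ⟨hJ.1.mono (subset_starD _ _ _), (vOp_bdd S J hJ).mono (fun y hy => (mem_starD.1 hy).1), ?_⟩
  intro y hy s hs
  rw [mem_starD] at hy ⊢
  exact ⟨vOp_cl S _ _ (natS_frac S).2.2 y hy.1 s hs,
    fun I hI => vOp_cl S _ _ (hΘ I hI) y (hy.2 I hI) s hs⟩

lemma transl_frac {S : NumSgp} {J : Set ℤ} (hJ : IsFracIdeal S J) (a : ℤ) :
    IsFracIdeal S ((fun x => a + x) '' J) := by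
  refine ⟨hJ.1.image _, ?_, ?_⟩
  · obtain ⟨m, hm⟩ := hJ.2.1
    refine ⟨a + m, ?_⟩
    rintro _ ⟨j, hj, rfl⟩
    have := hm hj
    simpa using this
  · rintro _ ⟨j, hj, rfl⟩ s hs
    exact ⟨j + s, hJ.2.2 j hj s hs, by ring⟩

open Classical in
/-- the star operation generated by a set of ideals -/
noncomputable def mk (S : NumSgp) (Θ : Set (Set ℤ)) (hΘ : ∀ I ∈ Θ, Cl S I) : StarOp S where
  toFun J := if IsFracIdeal S J then starD S Θ J else J
  isFrac I hI := by
    rw [if_pos hI]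
    exact starD_frac hΘ hI
  subset_star I hI := by
    rw [if_pos hI]
    exact subset_starD _ _ _
  mono I J hI hJ h := by
    rw [if_pos hI, if_pos hJ]
    intro y hy
    rw [mem_starD] at hy ⊢
    exact ⟨dd_mono h hy.1, fun K hK => dd_mono h (hy.2 K hK)⟩
  idem I hI := by
    rw [if_pos hI, if_pos (starD_frac hΘ hI)]
    apply subset_antisymm _ (subset_starD _ _ _)
    intro y hy
    rw [mem_starD] at hy ⊢
    exact ⟨dd_idem (fun z hz => (mem_starD.1 hz).1) hy.1,
      fun K hK => dd_idem (fun z hz => (mem_starD.1 hz).2 K hK) (hy.2 K hK)⟩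
  transl I hI a := by
    rw [if_pos hI, if_pos (transl_frac hI a)]
    ext y
    rw [mem_starD]
    unfold vOp
    simp only [dd_transl]
    constructor
    · intro h
      exact ⟨y - a, mem_starD.2 h, by ring⟩
    · rintro ⟨z, hz, rfl⟩
      have := mem_starD.1 hz
      simpa [vOp] using this
  star_S := by
    rw [if_pos (natS_frac S)]
    apply subset_antisymm _ (subset_starD _ _ _)
    intro y hy
    have := (mem_starD.1 hy).1 0 (fun j hj => by simpa using hj)
    simpa using this
  default_eq I hI := by rw [if_neg hI]

lemma mem_mk {S : NumSgp} {Θ : Set (Set ℤ)} (hΘ : ∀ I ∈ Θ, Cl S I) {J : Set ℤ}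
    (hJ : IsFracIdeal S J) {y : ℤ} :
    y ∈ (mk S Θ hΘ).toFun J ↔
      y ∈ vOp S J ∧ ∀ I ∈ Θ, y ∈ idealSub I (idealSub I J) := by
  unfold mk
  simp only [if_pos hJ]
  exact mem_starD

/-! ### Finiteness -/

lemma starOp_ext {S : NumSgp} {s t : StarOp S} (h : ∀ I, IsFracIdeal S I → s.toFun I = t.toFun I) :
    s = t := by
  have : s.toFun = t.toFun := by
    funext I
    by_cases hI : IsFracIdeal S I
    · exact h I hI
    · rw [s.default_eq I hI, t.default_eq I hI]
  cases s
  cases t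
  simp only at this
  subst this
  rfl

lemma starOp_bound {S : NumSgp} (s : StarOp S) {c : ℤ} (h : ∀ x, c ≤ x → x ∈ natS S)
    {J : Set ℤ} (hJ : IsFracIdeal S J) (h0 : ∀ j ∈ J, 0 ≤ j) : ∀ y ∈ s.toFun J, -c ≤ y := by
  intro y hy
  have h1 : c + y ∈ s.toFun ((fun x => c + x) '' J) := by
    rw [s.transl J hJ]
    exact ⟨y, hy, rfl⟩
  have h2 := s.mono _ _ (transl_frac hJ c) (natS_frac S) (by
    rintro _ ⟨j, hj, rfl⟩
    exact h _ (by have := h0 j hj; simp only; omega)) h1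
  rw [s.star_S] at h2
  have := natS_nonneg h2
  omega

instance starOp_finite (S : NumSgp) : Finite (StarOp S) := by
  obtain ⟨c, hc, h⟩ := exists_cond S
  let f : StarOp S → (Set (Icc (-c) c) → Set (Icc (-c) c)) :=
    fun s W => Subtype.val ⁻¹' (s.toFun (Subtype.val '' W ∪ Ici c))
  have hf : Function.Injective f := by
    intro s t hst
    apply starOp_ext
    intro I hI
    obtain ⟨m, hm, hmin⟩ := Int.exists_least_of_bdd (P := fun z => z ∈ I)
      (by obtain ⟨b, hb⟩ := hI.2.1; exact ⟨b, fun z hz => hb hz⟩) hI.1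
    set J := (fun x => -m + x) '' I with hJd
    have hJ : IsFracIdeal S J := transl_frac hI _
    have hIJ : I = (fun x => m + x) '' J := by
      rw [hJd, Set.image_image]
      simp
    have hJ0 : ∀ j ∈ J, 0 ≤ j := by
      rintro _ ⟨i, hi, rfl⟩
      have := hmin i hi
      simp only
      omega
    have h0J : (0 : ℤ) ∈ J := ⟨m, hm, by simp⟩
    have hcJ : ∀ x, c ≤ x → x ∈ J := fun x hx => by
      simpa using hJ.2.2 0 h0J x (h x hx)
    have hW : J = Subtype.val '' (Subtype.val ⁻¹' J : Set (Icc (-c) c)) ∪ Ici c := by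
      ext x
      constructor
      · intro hx
        by_cases hxc : c ≤ x
        · exact Or.inr hxc
        · exact Or.inl ⟨⟨x, by have := hJ0 x hx; constructor <;> omega⟩, hx, rfl⟩
      · rintro (⟨z, hz, rfl⟩ | hx)
        · exact hz
        · exact hcJ x hx
    have key : s.toFun J = t.toFun J := by
      have hfe := congrFun hst (Subtype.val ⁻¹' J : Set (Icc (-c) c))
      simp only [f, ← hW] at hfe
      ext x
      by_cases hx1 : c ≤ x
      · exact ⟨fun _ => t.subset_star J hJ (hcJ x hx1), fun _ => s.subset_star J hJ (hcJ x hx1)⟩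
      by_cases hx2 : -c ≤ x
      · have := Set.ext_iff.1 hfe ⟨x, hx2, by omega⟩
        simpa using this
      · exact ⟨fun hx => absurd (starOp_bound s h hJ hJ0 x hx) hx2,
          fun hx => absurd (starOp_bound t h hJ hJ0 x hx) hx2⟩
    rw [hIJ, s.transl J hJ, t.transl J hJ, key]
  exact Finite.of_injective f hf

/-! ### The families of ideals -/

/-- the ideal attached to level `i` and `A` -/
def L (S : NumSgp) (τ : ℕ → ℤ) (i : ℕ) (A : Set (Fin i)) : Set ℤ :=
  {x | x ∈ natS S ∨ (∃ j ∈ A, x = τ j) ∨ τ i < x}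

/-- the maximal ideal avoiding `b` -/
def Mx (S : NumSgp) (b : ℤ) : Set ℤ := {x | 0 ≤ x ∧ b - x ∉ natS S}

/-- enumeration of `T` -/
structure Enum (S : NumSgp) (t : ℕ) (τ : ℕ → ℤ) : Prop where
  mem : ∀ i, i < t → τ i ∈ Tset S
  lt : ∀ i j, i < j → j < t → τ i < τ j
  nonneg : ∀ i, i < t → 0 ≤ τ i

lemma Enum.inj {S : NumSgp} {t : ℕ} {τ : ℕ → ℤ} (E : Enum S t τ) {i j : ℕ} (hi : i < t)
    (hj : j < t) (h : τ i = τ j) : i = j := by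
  rcases lt_trichotomy i j with h1 | h1 | h1
  · have := E.lt i j h1 hj
    omega
  · exact h1
  · have := E.lt j i h1 hi
    omega

lemma Enum.notS {S : NumSgp} {t : ℕ} {τ : ℕ → ℤ} (E : Enum S t τ) {i : ℕ} (hi : i < t) :
    τ i ∉ natS S := (mem_Tset.1 (E.mem i hi)).2

lemma Enum.addS {S : NumSgp} {t : ℕ} {τ : ℕ → ℤ} (E : Enum S t τ) {i : ℕ} (hi : i < t) {s : ℤ}
    (hs : s ∈ natS S) (h0 : s ≠ 0) : τ i + s ∈ natS S := (mem_Tset.1 (E.mem i hi)).1 s hs h0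

lemma L_nonneg {S : NumSgp} {t : ℕ} {τ : ℕ → ℤ} (E : Enum S t τ) {i : ℕ} (hi : i < t)
    (A : Set (Fin i)) : ∀ x ∈ L S τ i A, 0 ≤ x := by
  rintro x (hx | ⟨j, _, rfl⟩ | hx)
  · exact natS_nonneg hx
  · exact E.nonneg _ (by omega)
  · have := E.nonneg i hi
    omega

lemma L_cl {S : NumSgp} {t : ℕ} {τ : ℕ → ℤ} (E : Enum S t τ) {i : ℕ} (hi : i < t)
    (A : Set (Fin i)) : Cl S (L S τ i A) := by
  rintro x hx s hs
  by_cases h0 : s = 0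
  · simpa [h0] using hx
  rcases hx with hx | ⟨j, _, rfl⟩ | hx
  · exact Or.inl (natS_add hx hs)
  · exact Or.inl (E.addS (by omega) hs h0)
  · have := natS_nonneg hs
    exact Or.inr (Or.inr (by omega))

lemma L_zero {S : NumSgp} {τ : ℕ → ℤ} {i : ℕ} (A : Set (Fin i)) : (0 : ℤ) ∈ L S τ i A :=
  Or.inl (natS_zero S)

lemma L_not {S : NumSgp} {t : ℕ} {τ : ℕ → ℤ} (E : Enum S t τ) {i : ℕ} (hi : i < t)
    (A : Set (Fin i)) : τ i ∉ L S τ i A := by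
  rintro (hx | ⟨j, _, h⟩ | hx)
  · exact E.notS hi hx
  · have := E.inj hi (by omega) h
    omega
  · omega

lemma L_frac {S : NumSgp} {t : ℕ} {τ : ℕ → ℤ} (E : Enum S t τ) {i : ℕ} (hi : i < t)
    (A : Set (Fin i)) : IsFracIdeal S (L S τ i A) :=
  ⟨⟨0, L_zero A⟩, ⟨0, fun x hx => L_nonneg E hi A x hx⟩, L_cl E hi A⟩

lemma L_sub {S : NumSgp} {t : ℕ} {τ : ℕ → ℤ} (E : Enum S t τ) {i : ℕ} (hi : i < t)
    {A B : Set (Fin i)} : L S τ i A ⊆ L S τ i B ↔ A ⊆ B := by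
  constructor
  · intro h j hj
    rcases h (Or.inr (Or.inl ⟨j, hj, rfl⟩)) with hx | ⟨k, hk, hjk⟩ | hx
    · exact absurd hx (E.notS (by omega))
    · have := E.inj (by omega) (by omega) hjk
      rwa [Fin.ext this]
    · have := E.lt j i j.2 hi
      omega
  · rintro h x (hx | ⟨j, hj, rfl⟩ | hx)
    · exact Or.inl hx
    · exact Or.inr (Or.inl ⟨j, h hj, rfl⟩)
    · exact Or.inr (Or.inr hx)

lemma Mx_cl (S : NumSgp) (b : ℤ) : Cl S (Mx S b) := by
  rintro x ⟨h0, hx⟩ s hs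
  refine ⟨by have := natS_nonneg hs; omega, fun h => hx ?_⟩
  have := natS_add h hs
  rwa [show b - (x + s) + s = b - x by ring] at this

lemma Mx_zero {S : NumSgp} {b : ℤ} (hb : b ∉ natS S) : (0 : ℤ) ∈ Mx S b := ⟨le_rfl, by simpa using hb⟩

lemma Mx_frac {S : NumSgp} {b : ℤ} (hb : b ∉ natS S) : IsFracIdeal S (Mx S b) :=
  ⟨⟨0, Mx_zero hb⟩, ⟨0, fun _ hx => hx.1⟩, Mx_cl S b⟩

lemma Mx_gt {S : NumSgp} {b x : ℤ} (hb : 0 ≤ b) (h : b < x) : x ∈ Mx S b :=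
  ⟨by omega, fun hs => by have := natS_nonneg hs; omega⟩

/-- goodness: the ideal is not `S` -/
def Good (t k : ℕ) (A : Set (Fin k)) : Prop := k + 1 < t ∨ A.Nonempty

lemma mem_vOp_of {S : NumSgp} {J : Set ℤ} {y τ : ℤ} (h0 : (0 : ℤ) ∈ J) (hy : y ∈ J)
    (hyS : y ∉ natS S) (hτ : τ ∈ Tset S) : τ ∈ vOp S J := by
  intro x hx
  refine (mem_Tset.1 hτ).1 x (by simpa using hx 0 h0) ?_
  rintro rfl
  exact hyS (by simpa using hx y hy)

lemma L_v {S : NumSgp} {t : ℕ} {τ : ℕ → ℤ} (E : Enum S t τ) {i : ℕ} (hi : i < t)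
    {A : Set (Fin i)} (hA : Good t i A) : τ i ∈ vOp S (L S τ i A) := by
  rcases hA with h | ⟨j, hj⟩
  · exact mem_vOp_of (L_zero A) (y := τ (i + 1)) (Or.inr (Or.inr (E.lt _ _ (by omega) h)))
      (E.notS h) (E.mem i hi)
  · exact mem_vOp_of (L_zero A) (y := τ j) (Or.inr (Or.inl ⟨j, hj, rfl⟩))
      (E.notS (by omega)) (E.mem i hi)

lemma low {I J : Set ℤ} {a b : ℤ} (hI0 : ∀ x ∈ I, 0 ≤ x) (hI : ∀ x, a < x → x ∈ I)
    (h0 : (0 : ℤ) ∈ J) (hab : a < b) : b ∈ idealSub I (idealSub I J) := by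
  intro x hx
  have := hI0 _ (hx 0 h0)
  exact hI _ (by omega)

lemma same {I J : Set ℤ} {a : ℤ} (hI0 : ∀ x ∈ I, 0 ≤ x) (hI : ∀ x, a < x → x ∈ I)
    (ha : a ∉ I) (h0 : (0 : ℤ) ∈ J) : a ∈ idealSub I (idealSub I J) ↔ ¬ J ⊆ I := by
  constructor
  · intro h hJ
    apply ha
    simpa using h 0 (fun j hj => by simpa using hJ hj)
  · intro h x hx
    have := hI0 _ (hx 0 h0)
    apply hI
    by_contra hx0
    have : x = 0 := by omega
    subst this
    exact h (fun j hj => by simpa using hx j hj)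

/-- the lower-level ideals added (none, or `Mx`) -/
def extra (S : NumSgp) (τ : ℕ → ℤ) (i : ℕ) (e : Bool) : Set (Set ℤ) :=
  {I | e = true ∧ 1 ≤ i ∧ I = Mx S (τ (i - 1))}

def gen (S : NumSgp) (τ : ℕ → ℤ) (i : ℕ) (Δ : Set (Set (Fin i))) (e : Bool) : Set (Set ℤ) :=
  (L S τ i '' Δ) ∪ extra S τ i e

lemma gen_cl {S : NumSgp} {t : ℕ} {τ : ℕ → ℤ} (E : Enum S t τ) {i : ℕ} (hi : i < t)
    (Δ : Set (Set (Fin i))) (e : Bool) : ∀ I ∈ gen S τ i Δ e, Cl S I := by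
  rintro I (⟨A, _, rfl⟩ | ⟨_, _, rfl⟩)
  · exact L_cl E hi A
  · exact Mx_cl S _

noncomputable def op {S : NumSgp} {t : ℕ} {τ : ℕ → ℤ} (E : Enum S t τ) {i : ℕ} (hi : i < t)
    (Δ : Set (Set (Fin i))) (e : Bool) : StarOp S := mk S (gen S τ i Δ e) (gen_cl E hi Δ e)

lemma op_high {S : NumSgp} {t : ℕ} {τ : ℕ → ℤ} (E : Enum S t τ) {i : ℕ} (hi : i < t)
    (Δ : Set (Set (Fin i))) (e : Bool) {k : ℕ} (hik : i < k) (hk : k < t) {A : Set (Fin k)}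
    (hA : Good t k A) : τ k ∈ (op E hi Δ e).toFun (L S τ k A) := by
  rw [op, mem_mk _ (L_frac E hk A)]
  refine ⟨L_v E hk hA, ?_⟩
  rintro I (⟨B, _, rfl⟩ | ⟨_, h1, rfl⟩)
  · exact low (L_nonneg E hi B) (fun x hx => Or.inr (Or.inr hx)) (L_zero A) (E.lt i k hik hk)
  · exact low (fun x hx => hx.1) (fun x hx => Mx_gt (E.nonneg _ (by omega)) hx) (L_zero A)
      (E.lt (i - 1) k (by omega) hk)

lemma op_same {S : NumSgp} {t : ℕ} {τ : ℕ → ℤ} (E : Enum S t τ) {i : ℕ} (hi : i < t)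
    (Δ : Set (Set (Fin i))) (e : Bool) {A : Set (Fin i)}
    (hA : Good t i A) : τ i ∉ (op E hi Δ e).toFun (L S τ i A) ↔ ∃ B ∈ Δ, A ⊆ B := by
  have hs : ∀ B : Set (Fin i), τ i ∈ idealSub (L S τ i B) (idealSub (L S τ i B) (L S τ i A)) ↔
      ¬ A ⊆ B := by
    intro B
    rw [same (L_nonneg E hi B) (fun x hx => Or.inr (Or.inr hx)) (L_not E hi B) (L_zero A),
      L_sub E hi]
  rw [op, mem_mk _ (L_frac E hi A)]
  constructor
  · intro h
    by_contra hcon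
    push Not at hcon
    apply h
    refine ⟨L_v E hi hA, ?_⟩
    rintro I (⟨B, hB, rfl⟩ | ⟨_, h1, rfl⟩)
    · exact (hs B).2 (hcon B hB)
    · exact low (fun x hx => hx.1) (fun x hx => Mx_gt (E.nonneg _ (by omega)) hx) (L_zero A)
        (E.lt (i - 1) i (by omega) hi)
  · rintro ⟨B, hB, hAB⟩ ⟨_, h⟩
    exact (hs B).1 (h _ (Or.inl ⟨B, hB, rfl⟩)) hAB

lemma op_Mx_true {S : NumSgp} {t : ℕ} {τ : ℕ → ℤ} (E : Enum S t τ) {i : ℕ} (hi : i < t)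
    (h1 : 1 ≤ i) (Δ : Set (Set (Fin i))) :
    τ (i - 1) ∉ (op E hi Δ true).toFun (Mx S (τ (i - 1))) := by
  rw [op, mem_mk _ (Mx_frac (E.notS (by omega)))]
  rintro ⟨_, h⟩
  have := h _ (Or.inr ⟨rfl, h1, rfl⟩) 0 (fun j hj => by simpa using hj)
  have h2 := this.2
  apply h2
  simpa using natS_zero S

lemma op_Mx_false {S : NumSgp} {t : ℕ} {τ : ℕ → ℤ} (E : Enum S t τ) {i : ℕ} (hi : i < t)
    (h1 : 1 ≤ i) (Δ : Set (Set (Fin i))) (hΔ : Set.univ ∉ Δ) :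
    τ (i - 1) ∈ (op E hi Δ false).toFun (Mx S (τ (i - 1))) := by
  have hb : τ (i - 1) ∉ natS S := E.notS (by omega)
  have hb0 : 0 ≤ τ (i - 1) := E.nonneg _ (by omega)
  have hba : τ (i - 1) < τ i := E.lt _ _ (by omega) hi
  have haM : τ i ∈ Mx S (τ (i - 1)) := Mx_gt hb0 hba
  rw [op, mem_mk _ (Mx_frac hb)]
  refine ⟨mem_vOp_of (Mx_zero hb) haM (E.notS hi) (E.mem _ (by omega)), ?_⟩
  rintro I (⟨B, hB, rfl⟩ | ⟨h, _⟩)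
  · intro x hx
    by_contra hn
    rw [add_comm] at hn
    have hx0 : 0 ≤ x := L_nonneg E hi B _ (by simpa using hx 0 (Mx_zero hb))
    have hle : x + τ (i - 1) ≤ τ i := by
      by_contra hlt
      exact hn (Or.inr (Or.inr (by omega)))
    have hax : τ i - x ∉ Mx S (τ (i - 1)) := by
      intro h
      apply L_not E hi B
      have := hx _ h
      rwa [show x + (τ i - x) = τ i by ring] at this
    have hS : τ (i - 1) - (τ i - x) ∈ natS S := by
      by_contra h
      exact hax ⟨by omega, h⟩
    have hxe : x = τ i - τ (i - 1) := by
      have := natS_nonneg hS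
      omega
    have key : ∀ j : Fin i, ∃ k : Fin i, k ∈ B ∧ τ i - τ j = τ k := by
      intro j
      have hji : τ j < τ i := E.lt _ _ j.2 hi
      have hjle : τ j ≤ τ (i - 1) := by
        rcases Nat.lt_or_ge j (i - 1) with h | h
        · exact (E.lt _ _ h (by omega)).le
        · rw [show (j : ℕ) = i - 1 by omega]
      have hjS : τ j ∉ natS S := E.notS (by omega)
      have hm := hx (τ (i - 1) - τ j) ⟨by omega, by simpa using hjS⟩
      rw [hxe, show τ i - τ (i - 1) + (τ (i - 1) - τ j) = τ i - τ j by ring] at hm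
      rcases hm with hm | ⟨k, hk, h⟩ | hm
      · exfalso
        apply E.notS hi
        have := E.addS (i := j) (by omega) hm (by omega)
        rwa [show τ j + (τ i - τ j) = τ i by ring] at this
      · exact ⟨k, hk, h⟩
      · have := E.nonneg j (by omega)
        omega
    choose f hf using key
    have hinj : Function.Injective f := by
      intro j j' hjj
      have e1 := (hf j).2
      have e2 := (hf j').2
      rw [hjj] at e1
      exact Fin.ext (E.inj (by omega) (by omega) (by omega))
    have hsurj := Finite.surjective_of_injective hinj
    apply hΔ
    have : B = Set.univ := by
      apply Set.eq_univ_of_forall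
      intro k
      obtain ⟨j, rfl⟩ := hsurj k
      exact (hf j).1
    rwa [← this]
  · simp at h

/-! ### Counting -/

/-- admissible antichains at level `i` -/
def N (t i : ℕ) : Set (Set (Set (Fin i))) :=
  {Δ | IsAntichain (· ⊆ ·) Δ ∧ Δ.Nonempty ∧ (i + 1 < t ∨ Δ ≠ {∅})}

lemma N_good {t i : ℕ} {Δ : Set (Set (Fin i))} (h : Δ ∈ N t i) {A : Set (Fin i)} (hA : A ∈ Δ) :
    Good t i A := by
  obtain ⟨h1, _, h | h⟩ := h
  · exact Or.inl h
  · right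
    by_contra hne
    rw [Set.not_nonempty_iff_eq_empty] at hne
    subst hne
    apply h
    ext B
    constructor
    · intro hB
      exact (h1.eq hA hB (Set.empty_subset B)).symm
    · rintro rfl
      exact hA

/-- star operations of level `i` -/
def P (S : NumSgp) (τ : ℕ → ℤ) (t i : ℕ) : Set (StarOp S) :=
  {s | (∃ A, Good t i A ∧ τ i ∉ s.toFun (L S τ i A)) ∧
    ∀ k, i < k → k < t → ∀ A, Good t k A → τ k ∈ s.toFun (L S τ k A)}

lemma op_mem_P {S : NumSgp} {t : ℕ} {τ : ℕ → ℤ} (E : Enum S t τ) {i : ℕ} (hi : i < t)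
    {Δ : Set (Set (Fin i))} (hΔ : Δ ∈ N t i) (e : Bool) : op E hi Δ e ∈ P S τ t i := by
  refine ⟨?_, fun k hik hk A hA => op_high E hi Δ e hik hk hA⟩
  obtain ⟨A, hA⟩ := hΔ.2.1
  exact ⟨A, N_good hΔ hA, (op_same E hi Δ e (N_good hΔ hA)).2 ⟨A, hA, subset_rfl⟩⟩

lemma op_inj_aux {S : NumSgp} {t : ℕ} {τ : ℕ → ℤ} (E : Enum S t τ) {i : ℕ} (hi : i < t)
    {Δ Δ' : Set (Set (Fin i))} (hΔ : Δ ∈ N t i) (hΔ' : Δ' ∈ N t i) {e e' : Bool}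
    (h : op E hi Δ e = op E hi Δ' e') : Δ ⊆ Δ' := by
  have hh : ∀ A, Good t i A → ((∃ B ∈ Δ, A ⊆ B) ↔ ∃ B ∈ Δ', A ⊆ B) := by
    intro A hA
    rw [← op_same E hi Δ e hA, h, op_same E hi Δ' e' hA]
  intro A hA
  obtain ⟨B, hB, hAB⟩ := (hh A (N_good hΔ hA)).1 ⟨A, hA, subset_rfl⟩
  obtain ⟨C, hC, hBC⟩ := (hh B (N_good hΔ' hB)).2 ⟨B, hB, subset_rfl⟩
  have hAC : A = C := hΔ.1.eq hA hC (hAB.trans hBC)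
  have : A = B := subset_antisymm hAB (hAC ▸ hBC)
  rwa [this]

lemma op_inj {S : NumSgp} {t : ℕ} {τ : ℕ → ℤ} (E : Enum S t τ) {i : ℕ} (hi : i < t)
    {Δ Δ' : Set (Set (Fin i))} (hΔ : Δ ∈ N t i) (hΔ' : Δ' ∈ N t i) {e e' : Bool}
    (h : op E hi Δ e = op E hi Δ' e') : Δ = Δ' :=
  subset_antisymm (op_inj_aux E hi hΔ hΔ' h) (op_inj_aux E hi hΔ' hΔ h.symm)

lemma univ_not_mem {t i : ℕ} {Δ : Set (Set (Fin i))} (h : Δ ∈ N t i \ {{Set.univ}}) :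
    Set.univ ∉ Δ := by
  intro hu
  apply h.2
  ext B
  constructor
  · intro hB
    exact h.1.1.eq hB hu (Set.subset_univ B)
  · rintro rfl
    exact hu

lemma P_card {S : NumSgp} {t : ℕ} {τ : ℕ → ℤ} (E : Enum S t τ) {i : ℕ} (hi : i < t)
    (h1 : 1 ≤ i) : (N t i).ncard + (N t i \ {{Set.univ}}).ncard ≤ (P S τ t i).ncard := by
  rw [← Set.ncard_image_of_injOn (f := fun Δ => op E hi Δ false) (s := N t i)
      (fun Δ h Δ' h' hh => op_inj E hi h h' hh),
    ← Set.ncard_image_of_injOn (f := fun Δ => op E hi Δ true) (s := N t i \ {{Set.univ}})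
      (fun Δ h Δ' h' hh => op_inj E hi h.1 h'.1 hh),
    ← Set.ncard_union_eq]
  · refine Set.ncard_le_ncard ?_ (Set.toFinite _)
    rintro _ (⟨Δ, h, rfl⟩ | ⟨Δ, h, rfl⟩)
    · exact op_mem_P E hi h _
    · exact op_mem_P E hi h.1 _
  · rw [Set.disjoint_left]
    rintro _ ⟨Δ, h, rfl⟩ ⟨Δ', h', hh⟩
    have heq := op_inj E hi h'.1 h hh
    subst heq
    have := op_Mx_true E hi h1 Δ'
    simp only at hh
    rw [hh] at this
    exact this (op_Mx_false E hi h1 Δ' (univ_not_mem h'))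

lemma dedekind_eq (i : ℕ) :
    dedekind i = Set.ncard {A : Set (Set (Fin i)) | IsAntichain (· ⊆ ·) A} := rfl

lemma N_card1 {t i : ℕ} : dedekind i ≤ (N t i).ncard + 2 := by
  rw [dedekind_eq]
  calc _ ≤ (N t i ∪ {∅, {∅}}).ncard := by
        refine Set.ncard_le_ncard ?_ (Set.toFinite _)
        intro Δ h
        by_cases h1 : Δ = ∅
        · simp [h1]
        by_cases h2 : Δ = {∅}
        · simp [h2]
        exact Or.inl ⟨h, Set.nonempty_iff_ne_empty.2 h1, Or.inr h2⟩
    _ ≤ _ := (Set.ncard_union_le _ _).trans (by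
        gcongr
        exact (Set.ncard_insert_le _ _).trans (by simp))

lemma N_card2 {t i : ℕ} (hi : i + 1 < t) : dedekind i ≤ (N t i).ncard + 1 := by
  rw [dedekind_eq]
  calc _ ≤ (N t i ∪ {∅}).ncard := by
        refine Set.ncard_le_ncard ?_ (Set.toFinite _)
        intro Δ h
        by_cases h1 : Δ = ∅
        · simp [h1]
        exact Or.inl ⟨h, Set.nonempty_iff_ne_empty.2 h1, Or.inl hi⟩
    _ ≤ _ := (Set.ncard_union_le _ _).trans (by simp)

lemma N_card_diff {t i : ℕ} : (N t i).ncard ≤ (N t i \ {{Set.univ}}).ncard + 1 := by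
  have := Set.ncard_le_ncard_diff_add_ncard (N t i) {({Set.univ} : Set (Set (Fin i)))}
  simpa using this

lemma P_card0 {S : NumSgp} {t : ℕ} {τ : ℕ → ℤ} (E : Enum S t τ) (h : 1 < t) :
    1 ≤ (P S τ t 0).ncard := by
  rw [Nat.one_le_iff_ne_zero, ← Nat.pos_iff_ne_zero, Set.ncard_pos (Set.toFinite _)]
  refine ⟨op E (i := 0) (by omega) {∅} false, op_mem_P E _ ⟨?_, ?_, Or.inl h⟩ _⟩
  · exact Set.subsingleton_singleton.isAntichain _
  · simp

lemma P_disj {S : NumSgp} {t : ℕ} {τ : ℕ → ℤ} {i j : ℕ} (hj : j < t) (hij : i < j) :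
    Disjoint (P S τ t i) (P S τ t j) := by
  rw [Set.disjoint_left]
  rintro s ⟨_, h⟩ ⟨⟨A, hA, hn⟩, _⟩
  exact hn (h j hij hj A hA)

lemma total {S : NumSgp} {t : ℕ} {τ : ℕ → ℤ} (E : Enum S t τ) :
    1 + ∑ i ∈ Finset.range t, (P S τ t i).ncard ≤ Nat.card (StarOp S) := by
  classical
  have hfin : ∀ i, (P S τ t i).Finite := fun i => Set.toFinite _
  let F : ℕ → Finset (StarOp S) := fun i => (hfin i).toFinset
  have hF : ∀ i, (P S τ t i).ncard = (F i).card := fun i => Set.ncard_eq_toFinset_card _ _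
  have hU : ((Finset.range t).biUnion F).card = ∑ i ∈ Finset.range t, (F i).card := by
    apply Finset.card_biUnion
    intro i hi j hj hij
    simp only [Finset.coe_range, Finset.mem_range, Set.mem_Iio] at hi hj
    rw [Function.onFun, ← Finset.disjoint_coe]
    simp only [F, Set.Finite.coe_toFinset]
    rcases lt_or_gt_of_ne hij with h | h
    · exact P_disj hj h
    · exact (P_disj hi h).symm
  simp only [hF]
  rw [← hU]
  let v : StarOp S := mk S ∅ (by simp)
  have hv : v ∉ (Finset.range t).biUnion F := by
    simp only [Finset.mem_biUnion, Finset.mem_range, not_exists, not_and, F,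
      Set.Finite.mem_toFinset]
    rintro i hi ⟨⟨A, hA, hn⟩, _⟩
    apply hn
    rw [mem_mk _ (L_frac E hi A)]
    exact ⟨L_v E hi hA, by simp⟩
  rw [add_comm, ← Finset.card_insert_of_notMem hv]
  haveI := Fintype.ofFinite (StarOp S)
  rw [Nat.card_eq_fintype_card]
  exact Finset.card_le_univ _

lemma exists_enum (S : NumSgp) (h : 2 ≤ typeNum S) : ∃ τ, Enum S (typeNum S) τ := by
  have hc : (Tset_finite S).toFinset.card = typeNum S :=
    (Set.ncard_eq_toFinset_card _ _).symm
  let f := (Tset_finite S).toFinset.orderEmbOfFin hc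
  have hmem : ∀ i, f i ∈ Tset S := fun i => by
    have := Finset.orderEmbOfFin_mem (Tset_finite S).toFinset hc i
    exact (Set.Finite.mem_toFinset _).1 this
  refine ⟨fun i => if h : i < typeNum S then f ⟨i, h⟩ else 0, ?_, ?_, ?_⟩
  · intro i hi
    simp only [hi, dif_pos]
    exact hmem _
  · intro i j hij hj
    simp only [hj, hij.trans hj, dif_pos]
    exact f.strictMono (by simpa using hij)
  · intro i hi
    simp only [hi, dif_pos]
    obtain ⟨z, hz, hne⟩ := Set.exists_ne_of_one_lt_ncard (s := Tset S) h (f ⟨i, hi⟩)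
    exact Tset_nonneg (hmem _) hz hne

end StarCount

open StarCount in
/-- `|Star(S)| ≥ 2·(Σ_{i=1}^{t−1} D(i)) − 3(t − 1)`. -/
theorem card_star_ge_sum_dedekind (S : NumSgp) :
    2 * (∑ i ∈ Finset.Icc 1 (typeNum S - 1), (dedekind i : ℤ)) -
        3 * ((typeNum S : ℤ) - 1) ≤ (Nat.card (StarOp S) : ℤ) := by
  have hpos : 1 ≤ typeNum S := by
    exact (Set.ncard_pos (Tset_finite S)).2 (Tset_nonempty S)
  by_cases h2 : 2 ≤ typeNum S
  swap
  · have : typeNum S = 1 := by omega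
    rw [this]
    simp
  obtain ⟨τ, E⟩ := exists_enum S h2
  have ht := total E
  generalize typeNum S = t at *
  obtain ⟨n, rfl⟩ : ∃ n, t = n + 2 := ⟨t - 2, by omega⟩
  rw [Finset.sum_range_succ, Finset.sum_range_succ'] at ht
  have h0 := P_card0 E (by omega)
  have hmid : ∀ i ∈ Finset.range n,
      (2 * (dedekind (i + 1) : ℤ) - 3) ≤ ((P S τ (n + 2) (i + 1)).ncard : ℤ) := by
    intro i hi
    rw [Finset.mem_range] at hi
    have a1 := P_card E (i := i + 1) (by omega) (by omega)
    have a2 := N_card2 (t := n + 2) (i := i + 1) (by omega)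
    have a3 := N_card_diff (t := n + 2) (i := i + 1)
    omega
  have hlast : (2 * (dedekind (n + 1) : ℤ) - 5) ≤ ((P S τ (n + 2) (n + 1)).ncard : ℤ) := by
    have a1 := P_card E (i := n + 1) (by omega) (by omega)
    have a2 := N_card1 (t := n + 2) (i := n + 1)
    have a3 := N_card_diff (t := n + 2) (i := n + 1)
    omega
  have hsum := Finset.sum_le_sum hmid
  rw [Finset.sum_sub_distrib, ← Finset.mul_sum] at hsum
  simp only [Finset.sum_const, Finset.card_range, nsmul_eq_mul] at hsum
  have e : ∑ i ∈ Finset.Icc 1 (n + 2 - 1), (dedekind i : ℤ) =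
      ∑ i ∈ Finset.range n, (dedekind (i + 1) : ℤ) + dedekind (n + 1) := by
    rw [← Finset.sum_range_succ (fun i => (dedekind (i + 1) : ℤ))]
    rw [Finset.range_eq_Ico, Finset.sum_Ico_add' (fun i => (dedekind i : ℤ)) 0 (n + 1) 1]
    congr 1
  rw [e]
  have ht' : (1 : ℤ) + (∑ i ∈ Finset.range n, ((P S τ (n + 2) (i + 1)).ncard : ℤ)
      + ((P S τ (n + 2) 0).ncard : ℤ) + ((P S τ (n + 2) (n + 1)).ncard : ℤ)) ≤
      (Nat.card (StarOp S) : ℤ) := by exact_mod_cast ht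
  have h0' : (1 : ℤ) ≤ ((P S τ (n + 2) 0).ncard : ℤ) := by exact_mod_cast h0
  push_cast
  linarith
end

section
/- Let S be a numerical semigroup with Frobenius number g and multiplicity μ, let ν := ⌈(μ − 1)/2⌉, and let a ≤ g/2 be a positive integer such that a ∉ S and g − a ∉ S. Then: (a) if a > μ, the number of antichains of Q_a(S) with respect to inclusion is at least D(ν); (b) if a > 2μ, the number of antichains of Q_a(S) with respect to inclusion is at least 2·D(ν) − 2; here D(n) is the n-th Dedekind number. -/
namespace QaAux

lemma mu_spec (S : NumSgp) : multNum S ∈ S.carrier ∧ 0 < multNum S ∧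
    ∀ s ∈ S.carrier, s ≠ 0 → multNum S ≤ s := by
  have hne : (S.carrier \ {0}).Nonempty := by
    have hinf : S.carrier.Infinite := by
      intro h
      exact Set.infinite_univ (by
        have := h.union S.cofinite
        rwa [Set.union_compl_self] at this : (Set.univ : Set ℕ).Finite)
    exact (hinf.sdiff (Set.finite_singleton 0)).nonempty
  have h := Nat.sInf_mem hne
  refine ⟨h.1, Nat.pos_of_ne_zero h.2, fun s hs h0 => Nat.sInf_le ⟨hs, h0⟩⟩

lemma frob_spec (S : NumSgp) (a : ℕ) (ha : a ∉ S.carrier) : frob S ∉ S.carrier ∧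
    ∀ s, frob S < s → s ∈ S.carrier := by
  have hb := S.cofinite.bddAbove
  refine ⟨Nat.sSup_mem (s := S.carrierᶜ) ⟨a, ha⟩ hb, fun s hs => ?_⟩
  by_contra h
  exact absurd (le_csSup hb (show s ∈ S.carrierᶜ from h)) (not_le.mpr hs)

lemma natS_iff (S : NumSgp) (x : ℤ) : x ∈ natS S ↔ 0 ≤ x ∧ x.toNat ∈ S.carrier := by
  constructor
  · rintro ⟨n, hn, rfl⟩
    simpa using hn
  · rintro ⟨h, h'⟩
    exact ⟨x.toNat, h', by simp [h]⟩

lemma natS_cast (S : NumSgp) (n : ℕ) : (n : ℤ) ∈ natS S ↔ n ∈ S.carrier := by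
  simp [natS_iff]

lemma natS_add (S : NumSgp) {x y : ℤ} (hx : x ∈ natS S) (hy : y ∈ natS S) : x + y ∈ natS S := by
  obtain ⟨n, hn, rfl⟩ := hx
  obtain ⟨m, hm, rfl⟩ := hy
  exact ⟨n + m, S.add_mem n hn m hm, by simp⟩

lemma natS_zero (S : NumSgp) : (0 : ℤ) ∈ natS S := ⟨0, S.zero_mem, rfl⟩

lemma natS_nsmul (S : NumSgp) {x y : ℤ} (hx : x ∈ natS S) (hy : y ∈ natS S) (k : ℕ) :
    x + k * y ∈ natS S := by
  induction k with
  | zero => simpa using hx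
  | succ k ih =>
    have := natS_add S ih hy
    push_cast
    convert this using 1
    ring

/-- If `x ∈ S`, `x ≤ y` and `μ ∣ y - x` then `y ∈ S`. -/
lemma natS_up (S : NumSgp) {x y : ℤ} (hx : x ∈ natS S) (hxy : x ≤ y)
    (hd : (multNum S : ℤ) ∣ y - x) : y ∈ natS S := by
  obtain ⟨c, hc⟩ := hd
  have hm := mu_spec S
  have hpos : (0 : ℤ) < multNum S := by exact_mod_cast hm.2.1
  have hc0 : 0 ≤ c := by
    by_contra h
    push Not at h
    nlinarith
  lift c to ℕ using hc0
  have := natS_nsmul S hx ((natS_cast S _).2 hm.1) c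
  convert this using 1
  linarith

/-- Working description of the members of `Q_a`. -/
def Good (S : NumSgp) (a : ℕ) (I : Set ℤ) : Prop :=
  (0 : ℤ) ∈ I ∧ (∀ x ∈ I, 0 ≤ x) ∧ (∀ x ∈ I, ∀ s ∈ natS S, x + s ∈ I) ∧ (a : ℤ) ∉ I ∧
    ∀ x : ℤ, (a : ℤ) < x → x ∈ I

lemma good_mem (S : NumSgp) (a : ℕ) (ha : a ∉ S.carrier)
    (hga : ((frob S : ℤ) - (a : ℤ)) ∉ natS S) (I : Set ℤ) (h : Good S a I) : I ∈ Qa S a := by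
  obtain ⟨h0, hn, hs, hna, hgt⟩ := h
  obtain ⟨hf, hf'⟩ := frob_spec S a ha
  refine ⟨⟨⟨⟨0, h0⟩, ⟨0, fun x hx => hn x hx⟩, hs⟩, fun s hS => by simpa using hs 0 h0 s hS, hn⟩,
    hna, hgt, ?_⟩
  intro x hx
  have hxS : x ∈ natS S := by simpa using hx 0 h0
  have hx0 := ((natS_iff S x).1 hxS).1
  rcases lt_trichotomy (x + a) (frob S) with h | h | h
  · exfalso
    have := hx (frob S - x) (hgt _ (by linarith))
    rw [add_sub_cancel] at this
    exact hf ((natS_cast S _).1 this)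
  · exact absurd (by rwa [← h, add_sub_cancel_right]) hga
  · rw [add_comm]
    rw [natS_iff]
    exact ⟨by omega, hf' _ (by omega)⟩

/-- The duality `I ↦ {x : a - x ∉ I}`. -/
def dual (a : ℕ) (I : Set ℤ) : Set ℤ := {x | (a : ℤ) - x ∉ I}

lemma good_dual (S : NumSgp) (a : ℕ) (I : Set ℤ) (h : Good S a I) : Good S a (dual a I) := by
  obtain ⟨h0, hn, hs, hna, hgt⟩ := h
  refine ⟨by simpa [dual] using hna, fun x hx => ?_, fun x hx s hS hmem => ?_,
    by simpa [dual] using h0, fun x hx hmem => ?_⟩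
  · by_contra hlt
    exact hx (hgt _ (by linarith))
  · apply hx
    have := hs _ hmem s hS
    convert this using 1
    ring
  · have := hn _ hmem
    linarith

/-- The ideals of the first family. -/
def phi (S : NumSgp) (a : ℕ) {n : ℕ} (e : Fin n → ℤ) (A : Set (Fin n)) : Set ℤ :=
  {x | x ∈ natS S ∨ (a : ℤ) < x ∨ ∃ i ∈ A, x = e i}

lemma good_phi (S : NumSgp) (a : ℕ) (ha : a ∉ S.carrier) (hma : multNum S < a) {n : ℕ}
    (e : Fin n → ℤ) (he : ∀ i, (a : ℤ) - multNum S < e i ∧ e i < a) (A : Set (Fin n)) :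
    Good S a (phi S a e A) := by
  have hm := mu_spec S
  refine ⟨Or.inl (natS_zero S), ?_, ?_, ?_, fun x hx => Or.inr (Or.inl hx)⟩
  · rintro x (hx | hx | ⟨i, _, rfl⟩)
    · exact ((natS_iff S x).1 hx).1
    · omega
    · have := he i
      omega
  · rintro x (hx | hx | ⟨i, hi, rfl⟩) s hs
    · exact Or.inl (natS_add S hx hs)
    · have := ((natS_iff S s).1 hs).1
      exact Or.inr (Or.inl (by omega))
    · obtain ⟨m, hmS, rfl⟩ := hs
      rcases eq_or_ne m 0 with rfl | h0
      · exact Or.inr (Or.inr ⟨i, hi, by simp⟩)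
      · have := hm.2.2 m hmS h0
        have := he i
        exact Or.inr (Or.inl (by push_cast; omega))
  · rintro (hx | hx | ⟨i, _, hx⟩)
    · exact ha ((natS_cast S a).1 hx)
    · omega
    · have := he i
      omega

lemma phi_le (S : NumSgp) (a : ℕ) {n : ℕ}
    (e : Fin n → ℤ) (hinj : Function.Injective e) (he : ∀ i, e i < a)
    (hS : ∀ i, e i ∉ natS S) (A B : Set (Fin n)) (h : phi S a e A ⊆ phi S a e B) : A ⊆ B := by
  intro i hi
  rcases h (show e i ∈ phi S a e A from Or.inr (Or.inr ⟨i, hi, rfl⟩)) with hx | hx | ⟨j, hj, hx⟩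
  · exact absurd hx (hS i)
  · have := he i
    omega
  · rwa [hinj hx]

lemma dual_le (a : ℕ) (I J : Set ℤ) (h : dual a I ⊆ dual a J) : J ⊆ I := by
  intro x hx
  by_contra hI
  exact h (show (a : ℤ) - x ∈ dual a I by simpa [dual] using hI) (by simpa using hx)

lemma Qa_finite (S : NumSgp) (a : ℕ) : (Qa S a).Finite := by
  refine ((Set.finite_Icc (0 : ℤ) a).finite_subsets.image (fun A => A ∪ Set.Ioi (a : ℤ))).subset ?_
  rintro I ⟨⟨_, _, hn⟩, _, hgt, _⟩
  refine ⟨I ∩ Set.Icc 0 a, Set.inter_subset_right, ?_⟩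
  ext x
  have hn1 := @hn x
  have hgt1 := hgt x
  simp only [Set.mem_union, Set.mem_inter_iff, Set.mem_Icc, Set.mem_Ioi, Set.mem_ofPred_eq] at *
  constructor
  · rintro (h | h)
    · exact h.1
    · exact hgt1 h
  · intro h
    by_cases hx : (a : ℤ) < x
    · exact Or.inr hx
    · exact Or.inl ⟨h, by tauto, by omega⟩

/-- The window contains at least `ν` non-elements of `S` besides `a`. -/
lemma window (S : NumSgp) (a : ℕ) (ha2 : 2 * a ≤ frob S) (haS : a ∉ S.carrier)
    (hga : ((frob S : ℤ) - (a : ℤ)) ∉ natS S) :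
    ∃ e : Fin ((multNum S - 1 + 1) / 2) → ℤ, Function.Injective e ∧
      (∀ i, (a : ℤ) - multNum S < e i ∧ e i < a) ∧ ∀ i, e i ∉ natS S := by
  classical
  have hm := mu_spec S
  have hf := (frob_spec S a haS).1
  rw [← natS_cast] at hf
  have hpos : (0 : ℤ) < multNum S := by exact_mod_cast hm.2.1
  set μ := multNum S with hμ
  set g := frob S with hg
  set W := Finset.Ioo ((a : ℤ) - μ) a with hW
  have hcard : (W.filter (· ∈ natS S)).card + (W.filter (· ∉ natS S)).card = μ - 1 := by
    rw [Finset.card_filter_add_card_filter_not, hW, Int.card_Ioo]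
    omega
  have hle : (W.filter (· ∈ natS S)).card ≤ (W.filter (· ∉ natS S)).card := by
    have hdv : ∀ i : ℤ, (μ : ℤ) ∣ (a + i - g) - (a + i - g) % μ := fun i =>
      Int.dvd_self_sub_emod
    refine Finset.card_le_card_of_injOn (fun i => a - (a + i - g) % μ) ?_ ?_
    · intro i hi
      simp only [hW, Finset.coe_filter, Finset.mem_Ioo, Set.mem_ofPred_eq] at hi ⊢
      obtain ⟨⟨h1, h2⟩, h3⟩ := hi
      have e1 := Int.emod_nonneg (a + i - g) hpos.ne'
      have e2 := Int.emod_lt_of_pos (a + i - g) hpos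
      have hd := hdv i
      refine ⟨⟨by linarith, ?_⟩, ?_⟩
      · rcases e1.lt_or_eq with h | h
        · linarith
        · exfalso
          rw [← h] at hd
          apply hga
          refine natS_up S h3 (by omega) ?_
          obtain ⟨c, hc⟩ := hd
          exact ⟨-c, by rw [mul_neg]; linarith⟩
      · intro hr
        have h4 : (g : ℤ) - i ∈ natS S := by
          refine natS_up S hr (by omega) ?_
          obtain ⟨c, hc⟩ := hd
          exact ⟨-c, by rw [mul_neg]; linarith⟩
        have := natS_add S h4 h3
        rw [sub_add_cancel] at this
        exact hf this
    · intro i hi j hj hij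
      simp only [hW, Finset.coe_filter, Finset.mem_Ioo, Set.mem_ofPred_eq] at hi hj hij
      have hij' : (a + i - g) % (μ : ℤ) = (a + j - g) % μ := by linarith
      have hd : (μ : ℤ) ∣ i - j := by
        have h := Int.ModEq.dvd (n := μ) (a := a + j - g) (b := a + i - g) hij'.symm
        convert h using 1
        ring
      have := Int.eq_zero_of_abs_lt_dvd hd (by rw [abs_lt]; constructor <;> linarith [hi.1.1, hi.1.2, hj.1.1, hj.1.2])
      linarith
  have hν : (μ - 1 + 1) / 2 ≤ (W.filter (· ∉ natS S)).card := by omega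
  obtain ⟨N, hN, hNc⟩ := Finset.exists_subset_card_eq hν
  refine ⟨fun i => ((N.equivFinOfCardEq hNc).symm i : ℤ), ?_, fun i => ?_, fun i => ?_⟩
  · exact Subtype.val_injective.comp (Equiv.injective _)
  · have := hN ((N.equivFinOfCardEq hNc).symm i).2
    simpa [hW] using (Finset.mem_filter.1 this).1
  · exact (Finset.mem_filter.1 (hN ((N.equivFinOfCardEq hNc).symm i).2)).2

lemma img_anti {n : ℕ} (f : Set (Fin n) → Set ℤ) (hf : ∀ A B, f A ⊆ f B → A ⊆ B ∨ B ⊆ A)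
    (Q : Set (Set ℤ)) (hQ : ∀ A, f A ∈ Q) (A : Set (Set (Fin n)))
    (hA : IsAntichain (· ⊆ ·) A) :
    f '' A ∈ {Δ : Set (Set ℤ) | Δ ⊆ Q ∧ IsAntichain (· ⊆ ·) Δ} := by
  refine ⟨by rintro _ ⟨B, _, rfl⟩; exact hQ B, ?_⟩
  rintro _ ⟨B, hB, rfl⟩ _ ⟨C, hC, rfl⟩ hne hle
  have hne' : B ≠ C := fun h => hne (by rw [h])
  rcases hf B C hle with h | h
  · exact hA hB hC hne' h
  · exact hA hC hB hne'.symm h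

lemma anti_finite {Q : Set (Set ℤ)} (hQ : Q.Finite) :
    {Δ : Set (Set ℤ) | Δ ⊆ Q ∧ IsAntichain (· ⊆ ·) Δ}.Finite :=
  hQ.finite_subsets.subset fun _ h => h.1

lemma card_img {n : ℕ} (f : Set (Fin n) → Set ℤ) (hf : Function.Injective f) :
    ((fun A => f '' A) '' {A : Set (Set (Fin n)) | IsAntichain (· ⊆ ·) A}).ncard = dedekind n := by
  rw [Set.ncard_image_of_injective _ hf.image_injective]
  rfl

end QaAux

open QaAux

/-- Lower bounds on the number of inclusion-antichains of `Q_a(S)` when `a ≤ g/2` and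
`a, g − a ∉ S`; here `ν = ⌈(μ − 1)/2⌉`. -/
theorem numInclAnti_Qa_lower_bounds (S : NumSgp) (a : ℕ) (ha0 : 0 < a)
    (ha2 : 2 * a ≤ frob S) (haS : a ∉ S.carrier)
    (hga : ((frob S : ℤ) - (a : ℤ)) ∉ natS S) :
    -- (a) if `a > μ` then `a_⊆(Q_a) ≥ D(ν)`
    (multNum S < a → dedekind ((multNum S - 1 + 1) / 2) ≤ numInclAnti (Qa S a)) ∧
    -- (b) if `a > 2μ` then `a_⊆(Q_a) ≥ 2·D(ν) − 2`
    (2 * multNum S < a →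
      2 * dedekind ((multNum S - 1 + 1) / 2) - 2 ≤ numInclAnti (Qa S a)) := by
  obtain ⟨e, hinj, he, heS⟩ := window S a ha2 haS hga
  generalize (multNum S - 1 + 1) / 2 = n at e hinj he heS ⊢
  have hle := phi_le S a e hinj (fun i => (he i).2) heS
  have hinj1 : Function.Injective (phi S a e) := fun A B h =>
    Set.Subset.antisymm (hle A B h.le) (hle B A h.ge)
  have hfin := anti_finite (Qa_finite S a)
  have hsub1 : multNum S < a → (fun A => phi S a e '' A) ''
      {A : Set (Set (Fin n)) | IsAntichain (· ⊆ ·) A} ⊆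
      {Δ : Set (Set ℤ) | Δ ⊆ Qa S a ∧ IsAntichain (· ⊆ ·) Δ} := by
    rintro hma _ ⟨A, hA, rfl⟩
    exact img_anti _ (fun A B h => Or.inl (hle A B h)) _
      (fun B => good_mem S a haS hga _ (good_phi S a haS hma e he B)) A hA
  constructor
  · intro hma
    rw [← card_img _ hinj1]
    exact Set.ncard_le_ncard (hsub1 hma) hfin
  · intro h2
    have hma : multNum S < a := by omega
    have hle2 : ∀ A B, dual a (phi S a e A) ⊆ dual a (phi S a e B) → B ⊆ A := fun A B h =>
      hle B A (dual_le a _ _ h)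
    have hinj2 : Function.Injective (fun A => dual a (phi S a e A)) := fun A B h =>
      Set.Subset.antisymm (hle2 B A (le_of_eq h.symm)) (hle2 A B (le_of_eq h))
    have hsub2 : (fun A => (fun A => dual a (phi S a e A)) '' A) ''
        {A : Set (Set (Fin n)) | IsAntichain (· ⊆ ·) A} ⊆
        {Δ : Set (Set ℤ) | Δ ⊆ Qa S a ∧ IsAntichain (· ⊆ ·) Δ} := by
      rintro _ ⟨A, hA, rfl⟩
      exact img_anti _ (fun A B h => Or.inr (hle2 A B h)) _
        (fun B => good_mem S a haS hga _ (good_dual S a _ (good_phi S a haS hma e he B))) A hA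
    -- a common member of the two families is unique
    have key : ∀ A B, phi S a e A = dual a (phi S a e B) →
        phi S a e A = {x : ℤ | (a : ℤ) < x ∨ (x ≤ a - multNum S ∧ x ∈ natS S) ∨
          ((a : ℤ) - multNum S < x ∧ x ≤ a ∧ (a : ℤ) - x ∉ natS S)} := by
      intro A B h
      ext x
      simp only [Set.mem_ofPred_eq]
      rcases lt_or_ge (a : ℤ) x with hx | hx
      · exact ⟨fun _ => Or.inl hx, fun _ => Or.inr (Or.inl hx)⟩
      rcases le_or_gt x (a - multNum S) with hx' | hx'
      · constructor
        · rintro (h1 | h1 | ⟨i, _, h1⟩)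
          · exact Or.inr (Or.inl ⟨hx', h1⟩)
          · exact Or.inl h1
          · have := he i
            omega
        · rintro (h1 | h1 | h1)
          · exact Or.inr (Or.inl h1)
          · exact Or.inl h1.2
          · omega
      · rw [h]
        constructor
        · intro h1
          exact Or.inr (Or.inr ⟨hx', hx, fun h3 => h1 (Or.inl h3)⟩)
        · rintro (h1 | h1 | h1)
          · omega
          · omega
          · rintro (h3 | h3 | ⟨i, _, h3⟩)
            · exact h1.2.2 h3
            · omega
            · have := he i
              omega
    set J : Set ℤ := {x : ℤ | (a : ℤ) < x ∨ (x ≤ a - multNum S ∧ x ∈ natS S) ∨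
          ((a : ℤ) - multNum S < x ∧ x ≤ a ∧ (a : ℤ) - x ∉ natS S)} with hJ
    set X := (fun A => phi S a e '' A) ''
      {A : Set (Set (Fin n)) | IsAntichain (· ⊆ ·) A} with hX
    set Y := (fun A => (fun A => dual a (phi S a e A)) '' A) ''
        {A : Set (Set (Fin n)) | IsAntichain (· ⊆ ·) A} with hY
    have hXc : X.ncard = dedekind n := card_img _ hinj1
    have hYc : Y.ncard = dedekind n := card_img _ hinj2
    have hXY : (X ∩ Y).ncard ≤ 2 := by
      have hs : X ∩ Y ⊆ {∅, {J}} := by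
        rintro D ⟨⟨A, _, hA⟩, ⟨B, _, hB⟩⟩
        have hD : D ⊆ {J} := by
          intro I hI
          have hI1 := hI
          rw [← hA] at hI
          rw [← hB] at hI1
          obtain ⟨P, _, rfl⟩ := hI
          obtain ⟨R, _, hR⟩ := hI1
          exact key P R hR.symm
        exact Set.subset_singleton_iff_eq.1 hD
      exact (Set.ncard_le_ncard hs (Set.toFinite _)).trans (by
        simpa using Set.ncard_insert_le (∅ : Set (Set ℤ)) {{J}})
    have hXf := hfin.subset (hsub1 hma)
    have hYf := hfin.subset hsub2
    have hu := Set.ncard_union_add_ncard_inter X Y hXf hYf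
    have hb : (X ∪ Y).ncard ≤ numInclAnti (Qa S a) :=
      Set.ncard_le_ncard (Set.union_subset (hsub1 hma) hsub2) hfin
    omega
end
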